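/- arXiv:1903.07093 — 2 statements merged into one kernel-verified Lean document; each statement's English description precedes it below -/
import Mathlib

section
/- Let γ be the standard Gaussian measure on ℝⁿ, f : ℝⁿ → ℝ twice continuously differentiable with dν = e^f dγ a probability measure having finite relative entropy D_KL(ν||γ) = ∫ f dν and finite Fisher information I(ν) = ∫ |∇f|² dν. Let K = {∇f(x) : x ∈ ℝⁿ}, D(ν) = ∫ sup_{t∈K} ⟨y, t⟩ dγ(y) (assumed finite) and M = −inf_x Δf(x) (assumed finite). Then (1/2) I(ν) ≤ D_KL(ν||γ) + M + D(ν). -/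
open MeasureTheory Real
open scoped RealInnerProductSpace ENNReal

noncomputable def stdGaussian (n : ℕ) : Measure (EuclideanSpace ℝ (Fin n)) :=
  (volume : Measure (EuclideanSpace ℝ (Fin n))).withDensity
    fun x => ENNReal.ofReal ((2 * π) ^ (-(n : ℝ) / 2) * Real.exp (-‖x‖ ^ 2 / 2))

noncomputable def lap {n : ℕ} (f : EuclideanSpace ℝ (Fin n) → ℝ)
    (x : EuclideanSpace ℝ (Fin n)) : ℝ :=
  ∑ i, fderiv ℝ (fun y => gradient f y) x (EuclideanSpace.single i 1) i

/-- `y ↦ sup_{t ∈ K} ⟨y, t⟩`. -/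
noncomputable def gaussWidthFn {n : ℕ} (K : Set (EuclideanSpace ℝ (Fin n)))
    (y : EuclideanSpace ℝ (Fin n)) : ℝ :=
  ⨆ t : K, ⟪y, (t : EuclideanSpace ℝ (Fin n))⟫

def IsCoupling {n : ℕ}
    (p : Measure (EuclideanSpace ℝ (Fin n) × EuclideanSpace ℝ (Fin n)))
    (ν γ : Measure (EuclideanSpace ℝ (Fin n))) : Prop :=
  p.map Prod.fst = ν ∧ p.map Prod.snd = γ

/-- Squared quadratic Wasserstein distance. -/
noncomputable def W2sq {n : ℕ} (ν γ : Measure (EuclideanSpace ℝ (Fin n))) : ℝ :=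
  sInf {r : ℝ | ∃ p, IsCoupling p ν γ ∧ IsProbabilityMeasure p ∧
    r = ∫ q, ‖q.1 - q.2‖ ^ 2 ∂p}


section PrekopaLeindler

theorem IsCompact.volume_add_volume_le {K L C : Set ℝ} (hK : IsCompact K) (hL : IsCompact L)
    (hK₀ : K.Nonempty) (hL₀ : L.Nonempty) (h : ∀ a ∈ K, ∀ b ∈ L, a + b ∈ C) :
    volume K + volume L ≤ volume C := by
  set a := sSup K
  set b := sInf L
  have ha : a ∈ K := hK.sSup_mem hK₀
  have hb : b ∈ L := hL.sInf_mem hL₀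
  set K' := (fun x => x + b) '' K with hK'
  set L' := (fun x => a + x) '' L with hL'
  have mL' : MeasurableSet L' :=
    (hL.image (continuous_const.add continuous_id)).measurableSet
  have hinter : K' ∩ L' ⊆ {a + b} := by
    rintro z ⟨⟨x, hx, rfl⟩, ⟨y, hy, hxy⟩⟩
    have h1 : x ≤ a := le_csSup hK.bddAbove hx
    have h2 : b ≤ y := csInf_le hL.bddBelow hy
    simp only [Set.mem_singleton_iff]
    simp only at hxy
    linarith
  have hz : volume (K' ∩ L') = 0 := measure_mono_null hinter (by simp)
  have hsub : K' ∪ L' ⊆ C := by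
    rintro z (⟨x, hx, rfl⟩ | ⟨y, hy, rfl⟩)
    · exact h _ hx _ hb
    · exact h _ ha _ hy
  calc volume K + volume L = volume K' + volume L' := by
        simp [hK', hL', Set.image_add_right, Set.image_add_left]
    _ = volume (K' ∪ L') := by
        rw [← measure_union_add_inter K' mL', hz, add_zero]
    _ ≤ volume C := measure_mono hsub

theorem MeasurableSet.volume_le_of_isCompact_le {A : Set ℝ} {c : ℝ≥0∞} (mA : MeasurableSet A)
    (h : ∀ K ⊆ A, IsCompact K → K.Nonempty → volume K ≤ c) :
    volume A ≤ c := by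
  rw [mA.measure_eq_iSup_isCompact]
  refine iSup_le fun K => iSup_le fun hKA => iSup_le fun hK => ?_
  rcases K.eq_empty_or_nonempty with rfl | hne
  · simp
  · exact h K hKA hK hne

/-- The Brunn-Minkowski inequality on the real line. -/
theorem volume_add_volume_le {A B C : Set ℝ} (mA : MeasurableSet A) (mB : MeasurableSet B)
    (hA : A.Nonempty) (hB : B.Nonempty) (h : ∀ a ∈ A, ∀ b ∈ B, a + b ∈ C) :
    volume A + volume B ≤ volume C := by
  have key : ∀ K ⊆ A, IsCompact K → K.Nonempty → volume K + volume B ≤ volume C := by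
    intro K hKA hK hK₀
    have hfin : volume K ≠ ∞ := hK.measure_lt_top.ne
    have hKC : volume K ≤ volume C := by
      obtain ⟨b, hb⟩ := hB
      simpa using hK.volume_add_volume_le isCompact_singleton hK₀ (Set.singleton_nonempty b)
        fun x hx y hy => h x (hKA hx) y (hy ▸ hb)
    have := mB.volume_le_of_isCompact_le (c := volume C - volume K)
      fun L hLB hL hL₀ => ENNReal.le_sub_of_add_le_left hfin
        (hK.volume_add_volume_le hL hK₀ hL₀ fun x hx y hy => h x (hKA hx) y (hLB hy))
    calc volume K + volume B ≤ volume K + (volume C - volume K) := by gcongr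
      _ = volume C := add_tsub_cancel_of_le hKC
  rcases eq_or_ne (volume B) ∞ with hBtop | hBtop
  · obtain ⟨a, ha⟩ := hA
    have := key {a} (by simpa using ha) isCompact_singleton (Set.singleton_nonempty a)
    rw [hBtop, add_top, top_le_iff] at this
    simp [this]
  · have hBC : volume B ≤ volume C := by
      obtain ⟨a, ha⟩ := hA
      exact le_add_self.trans
        (key {a} (by simpa using ha) isCompact_singleton (Set.singleton_nonempty a))
    have := mA.volume_le_of_isCompact_le (c := volume C - volume B)
      fun K hKA hK hK₀ => ENNReal.le_sub_of_add_le_right hBtop (key K hKA hK hK₀)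
    calc volume A + volume B ≤ (volume C - volume B) + volume B := by gcongr
      _ = volume C := tsub_add_cancel_of_le hBC

open scoped Pointwise in
theorem volume_convexComb_le {A B C : Set ℝ} {s t : ℝ} (hs : 0 < s) (ht : 0 < t)
    (mA : MeasurableSet A) (mB : MeasurableSet B)
    (hA : A.Nonempty) (hB : B.Nonempty) (h : ∀ a ∈ A, ∀ b ∈ B, s * a + t * b ∈ C) :
    ENNReal.ofReal s * volume A + ENNReal.ofReal t * volume B ≤ volume C := by
  have := volume_add_volume_le (A := s • A) (B := t • B) (C := C)
    (mA.const_smul₀ s) (mB.const_smul₀ t) hA.smul_set hB.smul_set (by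
      rintro _ ⟨a, ha, rfl⟩ _ ⟨b, hb, rfl⟩
      exact h a ha b hb)
  simpa [Measure.addHaar_smul, abs_of_pos hs, abs_of_pos ht] using this

theorem ENNReal.geom_mean_le_arith_mean2_weighted {s t : ℝ} (hs : 0 < s) (ht : 0 < t)
    (hst : s + t = 1) (a b : ℝ≥0∞) :
    a ^ s * b ^ t ≤ ENNReal.ofReal s * a + ENNReal.ofReal t * b := by
  rcases eq_or_ne a ∞ with rfl | ha
  · simp [ENNReal.mul_top, hs]
  rcases eq_or_ne b ∞ with rfl | hb
  · simp [ENNReal.mul_top, ht]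
  lift a to NNReal using ha
  lift b to NNReal using hb
  lift s to NNReal using hs.le
  lift t to NNReal using ht.le
  rw [← ENNReal.coe_rpow_of_nonneg _ hs.le, ← ENNReal.coe_rpow_of_nonneg _ ht.le]
  simp only [ENNReal.ofReal_coe_nnreal]
  exact_mod_cast NNReal.geom_mean_le_arith_mean2_weighted s t a b (by exact_mod_cast hst)

theorem lintegral_eq_lintegral_meas_lt_of_le_one {F : ℝ → ℝ≥0∞} (mF : Measurable F)
    (hF : ∀ x, F x ≤ 1) :
    ∫⁻ x, F x = ∫⁻ r in Set.Ioo (0 : ℝ) 1, volume {x | ENNReal.ofReal r < F x} := by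
  have hfin : ∀ x, F x ≠ ∞ := fun x => ((hF x).trans_lt ENNReal.one_lt_top).ne
  have h1 : ∫⁻ x, F x = ∫⁻ r in Set.Ioi (0 : ℝ), volume {x | r < (F x).toReal} := by
    rw [← lintegral_eq_lintegral_meas_lt volume (Filter.Eventually.of_forall fun x =>
      ENNReal.toReal_nonneg) mF.ennreal_toReal.aemeasurable]
    exact lintegral_congr fun x => (ENNReal.ofReal_toReal (hfin x)).symm
  have h2 : ∀ r : ℝ, 1 ≤ r → volume {x | r < (F x).toReal} = 0 := by
    intro r hr
    have : {x | r < (F x).toReal} = ∅ := by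
      ext x
      have : (F x).toReal ≤ 1 := ENNReal.toReal_le_of_le_ofReal zero_le_one (by simpa using hF x)
      simp only [Set.mem_ofPred_eq, Set.mem_empty_iff_false, iff_false, not_lt]
      linarith
    simp [this]
  rw [h1, ← Set.Ioo_union_Ici_eq_Ioi (zero_lt_one' ℝ), lintegral_union measurableSet_Ici
    (by rw [Set.disjoint_left]; rintro x hx hx'; exact absurd hx.2 (not_lt.2 hx')),
    setLIntegral_congr_fun measurableSet_Ici (fun r hr => h2 r hr), lintegral_zero, add_zero]
  refine setLIntegral_congr_fun measurableSet_Ioo fun r hr => ?_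
  simp only [ENNReal.ofReal_lt_iff_lt_toReal hr.1.le (hfin _)]

theorem prekopa_leindler_of_iSup_eq_one {F G H : ℝ → ℝ≥0∞} {s t : ℝ} (hs : 0 < s) (ht : 0 < t)
    (hst : s + t = 1) (mF : Measurable F) (mG : Measurable G) (mH : Measurable H)
    (hF : ⨆ x, F x = 1) (hG : ⨆ x, G x = 1)
    (h : ∀ x y, F x ^ s * G y ^ t ≤ H (s * x + t * y)) :
    (∫⁻ x, F x) ^ s * (∫⁻ x, G x) ^ t ≤ ∫⁻ x, H x := by
  refine (ENNReal.geom_mean_le_arith_mean2_weighted hs ht hst _ _).trans ?_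
  have hF1 : ∀ x, F x ≤ 1 := fun x => hF ▸ le_iSup F x
  have hG1 : ∀ x, G x ≤ 1 := fun x => hG ▸ le_iSup G x
  have mlev : ∀ {F : ℝ → ℝ≥0∞}, Measurable fun r : ℝ => volume {x | ENNReal.ofReal r < F x} := by
    intro F
    refine Antitone.measurable fun r r' hr => measure_mono ?_
    intro x hx
    exact (ENNReal.ofReal_le_ofReal hr).trans_lt hx
  calc _ = ∫⁻ r in Set.Ioo (0 : ℝ) 1,
        (ENNReal.ofReal s * volume {x | ENNReal.ofReal r < F x}
          + ENNReal.ofReal t * volume {x | ENNReal.ofReal r < G x}) := by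
        rw [lintegral_eq_lintegral_meas_lt_of_le_one mF hF1,
          lintegral_eq_lintegral_meas_lt_of_le_one mG hG1, lintegral_add_left (mlev.const_mul _),
          lintegral_const_mul _ mlev, lintegral_const_mul _ mlev]
    _ ≤ ∫⁻ r in Set.Ioo (0 : ℝ) 1, volume {x | ENNReal.ofReal r < min (H x) 1} := by
        refine setLIntegral_mono' measurableSet_Ioo fun r hr => ?_
        have hr1 : ENNReal.ofReal r < 1 := by simpa using hr.2
        have hr0 : ENNReal.ofReal r ≠ 0 := by simpa using hr.1
        obtain ⟨x, hx⟩ := lt_iSup_iff.1 (hF ▸ hr1 : ENNReal.ofReal r < ⨆ x, F x)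
        obtain ⟨y, hy⟩ := lt_iSup_iff.1 (hG ▸ hr1 : ENNReal.ofReal r < ⨆ x, G x)
        refine volume_convexComb_le hs ht (measurableSet_lt measurable_const mF)
          (measurableSet_lt measurable_const mG) ⟨x, hx⟩ ⟨y, hy⟩ fun a ha b hb => ?_
        refine lt_min ((?_ : _ < _).trans_le (h a b)) hr1
        calc ENNReal.ofReal r = ENNReal.ofReal r ^ s * ENNReal.ofReal r ^ t := by
              rw [← ENNReal.rpow_add _ _ hr0 ENNReal.ofReal_ne_top, hst, ENNReal.rpow_one]
          _ < F a ^ s * G b ^ t :=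
              ENNReal.mul_lt_mul (ENNReal.rpow_lt_rpow ha hs) (ENNReal.rpow_lt_rpow hb ht)
    _ = ∫⁻ x, min (H x) 1 :=
        (lintegral_eq_lintegral_meas_lt_of_le_one (mH.min measurable_const)
          fun x => min_le_right _ _).symm
    _ ≤ ∫⁻ x, H x := lintegral_mono fun x => min_le_left _ _

theorem prekopa_leindler_of_bounded {F G H : ℝ → ℝ≥0∞} {s t : ℝ} (hs : 0 < s) (ht : 0 < t)
    (hst : s + t = 1) (mF : Measurable F) (mG : Measurable G) (mH : Measurable H)
    (hF : ⨆ x, F x ≠ ∞) (hG : ⨆ x, G x ≠ ∞)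
    (h : ∀ x y, F x ^ s * G y ^ t ≤ H (s * x + t * y)) :
    (∫⁻ x, F x) ^ s * (∫⁻ x, G x) ^ t ≤ ∫⁻ x, H x := by
  set a := ⨆ x, F x with ha
  set b := ⨆ x, G x with hb
  rcases eq_or_ne a 0 with ha0 | ha0
  · have : ∀ x, F x = 0 := by simpa [ha, ENNReal.iSup_eq_zero] using ha0
    simp [this, hs]
  rcases eq_or_ne b 0 with hb0 | hb0
  · have : ∀ x, G x = 0 := by simpa [hb, ENNReal.iSup_eq_zero] using hb0
    simp [this, ht]
  have has0 : a ^ s ≠ 0 := by simp [ENNReal.rpow_eq_zero_iff, ha0, hF]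
  have hbt0 : b ^ t ≠ 0 := by simp [ENNReal.rpow_eq_zero_iff, hb0, hG]
  have hasf : a ^ s ≠ ∞ := ENNReal.rpow_ne_top_of_nonneg hs.le hF
  have hbtf : b ^ t ≠ ∞ := ENNReal.rpow_ne_top_of_nonneg ht.le hG
  have key := prekopa_leindler_of_iSup_eq_one (F := fun x => a⁻¹ * F x) (G := fun x => b⁻¹ * G x)
    (H := fun x => (a ^ s)⁻¹ * (b ^ t)⁻¹ * H x) hs ht hst (mF.const_mul _) (mG.const_mul _)
    (mH.const_mul _) (by rw [← ENNReal.mul_iSup, ← ha, ENNReal.inv_mul_cancel ha0 hF])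
    (by rw [← ENNReal.mul_iSup, ← hb, ENNReal.inv_mul_cancel hb0 hG]) (by
      intro x y
      rw [ENNReal.mul_rpow_of_nonneg _ _ hs.le, ENNReal.mul_rpow_of_nonneg _ _ ht.le,
        ENNReal.inv_rpow, ENNReal.inv_rpow, mul_mul_mul_comm]
      gcongr
      exact h x y)
  rw [lintegral_const_mul _ mF, lintegral_const_mul _ mG, lintegral_const_mul _ mH,
    ENNReal.mul_rpow_of_nonneg _ _ hs.le, ENNReal.mul_rpow_of_nonneg _ _ ht.le,
        ENNReal.inv_rpow, ENNReal.inv_rpow, mul_mul_mul_comm,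
    ← ENNReal.mul_inv (Or.inl has0) (Or.inl hasf)] at key
  exact (ENNReal.mul_le_mul_iff_right (ENNReal.inv_ne_zero.2 (ENNReal.mul_ne_top hasf hbtf))
    (ENNReal.inv_ne_top.2 (mul_ne_zero has0 hbt0))).1 key

/-- The Prékopa-Leindler inequality on the real line. -/
theorem prekopa_leindler_real {F G H : ℝ → ℝ≥0∞} {s t : ℝ} (hs : 0 < s) (ht : 0 < t)
    (hst : s + t = 1) (mF : Measurable F) (mG : Measurable G) (mH : Measurable H)
    (h : ∀ x y, F x ^ s * G y ^ t ≤ H (s * x + t * y)) :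
    (∫⁻ x, F x) ^ s * (∫⁻ x, G x) ^ t ≤ ∫⁻ x, H x := by
  rcases eq_or_ne (∫⁻ x, F x) 0 with hF0 | hF0
  · simp [hF0, hs]
  rcases eq_or_ne (∫⁻ x, G x) 0 with hG0 | hG0
  · simp [hG0, ht]
  have trunc : ∀ {F : ℝ → ℝ≥0∞}, Measurable F →
      Filter.Tendsto (fun k : ℕ => ∫⁻ x, min (F x) k) Filter.atTop (nhds (∫⁻ x, F x)) := by
    intro F mF
    refine lintegral_tendsto_of_tendsto_of_monotone
      (fun k => (mF.min measurable_const).aemeasurable) (.of_forall fun x k l hkl => ?_)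
      (.of_forall fun x => ?_)
    · exact min_le_min_left _ (by exact_mod_cast hkl)
    · simpa using (tendsto_const_nhds (x := F x)).min ENNReal.tendsto_nat_nhds_top
  refine le_of_tendsto (ENNReal.Tendsto.mul (((ENNReal.continuous_rpow_const (y := s)).tendsto _).comp
    (trunc mF)) (Or.inl ?_) (((ENNReal.continuous_rpow_const (y := t)).tendsto _).comp (trunc mG))
    (Or.inl ?_)) (.of_forall fun k => ?_)
  · simp [ENNReal.rpow_eq_zero_iff, hF0, hs.not_gt]
  · simp [ENNReal.rpow_eq_zero_iff, hG0, ht.not_gt]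
  have hb : ∀ F : ℝ → ℝ≥0∞, ⨆ x, min (F x) k ≠ ∞ := fun F =>
    ((iSup_le fun x => min_le_right _ _ : _ ≤ (k : ℝ≥0∞)).trans_lt (by simp)).ne
  refine prekopa_leindler_of_bounded hs ht hst (mF.min measurable_const) (mG.min measurable_const)
    mH (hb F) (hb G) fun x y => le_trans ?_ (h x y)
  gcongr <;> exact min_le_left _ _

/-- The Prékopa-Leindler inequality. -/
theorem prekopa_leindler {s t : ℝ} (hs : 0 < s) (ht : 0 < t) (hst : s + t = 1) :
    ∀ (n : ℕ) {F G H : (Fin n → ℝ) → ℝ≥0∞}, Measurable F → Measurable G → Measurable H →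
    (∀ x y, F x ^ s * G y ^ t ≤ H (s • x + t • y)) →
    (∫⁻ x, F x) ^ s * (∫⁻ x, G x) ^ t ≤ ∫⁻ x, H x
  | 0, F, G, H, _, _, _, h => by
    have := h default default
    rw [volume_pi, Measure.pi_of_empty _ default]
    rw [Subsingleton.elim (s • (default : Fin 0 → ℝ) + t • default) default] at this
    simpa only [lintegral_dirac] using this
  | n + 1, F, G, H, mF, mG, mH, h => by
    let e := (MeasurableEquiv.piFinSuccAbove (fun _ : Fin (n + 1) => ℝ) 0).symm
    have he : ∀ {F : (Fin (n + 1) → ℝ) → ℝ≥0∞}, Measurable F →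
        ∫⁻ x, F x = ∫⁻ a, ∫⁻ v, F (e (a, v)) := by
      intro F mF
      rw [← (volume_preserving_piFinSuccAbove (fun _ : Fin (n + 1) => ℝ) 0).symm.lintegral_comp mF]
      exact lintegral_prod _ (mF.comp e.measurable).aemeasurable
    have hm : ∀ {F : (Fin (n + 1) → ℝ) → ℝ≥0∞}, Measurable F →
        Measurable fun p : ℝ × (Fin n → ℝ) => F (e p) := fun mF => mF.comp e.measurable
    have hlin : ∀ a b v w, e (s * a + t * b, s • v + t • w) = s • e (a, v) + t • e (b, w) := by
      intro a b v w
      ext i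
      refine Fin.cases ?_ (fun j => ?_) i <;>
        simp [e, MeasurableEquiv.piFinSuccAbove]
    rw [he mF, he mG, he mH]
    refine prekopa_leindler_real hs ht hst (hm mF).lintegral_prod_right'
      (hm mG).lintegral_prod_right' (hm mH).lintegral_prod_right' fun a b => ?_
    refine prekopa_leindler hs ht hst n ((hm mF).comp measurable_prodMk_left)
      ((hm mG).comp measurable_prodMk_left) ((hm mH).comp measurable_prodMk_left) fun v w => ?_
    rw [hlin]
    exact h _ _

theorem prekopa_leindler_euclideanSpace {n : ℕ} {s t : ℝ} (hs : 0 < s) (ht : 0 < t)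
    (hst : s + t = 1) {F G H : EuclideanSpace ℝ (Fin n) → ℝ≥0∞} (mF : Measurable F)
    (mG : Measurable G) (mH : Measurable H)
    (h : ∀ x y, F x ^ s * G y ^ t ≤ H (s • x + t • y)) :
    (∫⁻ x, F x) ^ s * (∫⁻ x, G x) ^ t ≤ ∫⁻ x, H x := by
  have mp := PiLp.volume_preserving_toLp (Fin n)
  rw [← mp.lintegral_comp mF, ← mp.lintegral_comp mG, ← mp.lintegral_comp mH]
  exact prekopa_leindler hs ht hst n (mF.comp mp.measurable) (mG.comp mp.measurable)
    (mH.comp mp.measurable) fun x y => h _ _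

end PrekopaLeindler

section Gaussian

variable {n : ℕ}

noncomputable def stdGaussianDensity (n : ℕ) (x : EuclideanSpace ℝ (Fin n)) : ℝ :=
  (2 * π) ^ (-(n : ℝ) / 2) * Real.exp (-‖x‖ ^ 2 / 2)

theorem stdGaussianDensity_pos (x : EuclideanSpace ℝ (Fin n)) : 0 < stdGaussianDensity n x := by
  unfold stdGaussianDensity
  positivity

theorem continuous_stdGaussianDensity : Continuous (stdGaussianDensity n) := by
  unfold stdGaussianDensity
  fun_prop

theorem measurable_ofReal_stdGaussianDensity :
    Measurable fun x => ENNReal.ofReal (stdGaussianDensity n x) :=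
  continuous_stdGaussianDensity.measurable.ennreal_ofReal

theorem stdGaussian_eq_withDensity :
    stdGaussian n = volume.withDensity fun x => ENNReal.ofReal (stdGaussianDensity n x) := rfl

theorem integrable_exp_neg_mul_sq_norm {b : ℝ} (hb : 0 < b) :
    Integrable fun x : EuclideanSpace ℝ (Fin n) => Real.exp (-b * ‖x‖ ^ 2) := by
  refine Integrable.of_integral_ne_zero ?_
  rw [GaussianFourier.integral_rexp_neg_mul_sq_norm hb]
  positivity

theorem integral_stdGaussianDensity : ∫ x, stdGaussianDensity n x = 1 := by
  have h := GaussianFourier.integral_rexp_neg_mul_sq_norm (V := EuclideanSpace ℝ (Fin n))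
    (b := 1 / 2) (by norm_num)
  have h2 : ∀ x : EuclideanSpace ℝ (Fin n), -‖x‖ ^ 2 / 2 = -(1 / 2) * ‖x‖ ^ 2 := fun x => by ring
  simp only [stdGaussianDensity, h2]
  rw [integral_const_mul, h, finrank_euclideanSpace, Fintype.card_fin,
    show π / (1 / 2) = 2 * π by ring, ← Real.rpow_add (by positivity),
    show -(n : ℝ) / 2 + n / 2 = 0 by ring, Real.rpow_zero]

theorem lintegral_stdGaussianDensity :
    ∫⁻ x, ENNReal.ofReal (stdGaussianDensity n x) = 1 := by
  rw [← ofReal_integral_eq_lintegral_ofReal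
    (Integrable.of_integral_ne_zero (by simp [integral_stdGaussianDensity]))
    (.of_forall fun x => (stdGaussianDensity_pos x).le), integral_stdGaussianDensity,
    ENNReal.ofReal_one]

instance isProbabilityMeasure_stdGaussian : IsProbabilityMeasure (stdGaussian n) :=
  ⟨by rw [stdGaussian_eq_withDensity, withDensity_apply _ MeasurableSet.univ,
    Measure.restrict_univ, lintegral_stdGaussianDensity]⟩

theorem integrable_exp_mul_norm_stdGaussian (L : ℝ) :
    Integrable (fun x => Real.exp (L * ‖x‖)) (stdGaussian n) := by
  rw [stdGaussian_eq_withDensity,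
    integrable_withDensity_iff measurable_ofReal_stdGaussianDensity (by simp)]
  refine Integrable.mono' ((integrable_exp_neg_mul_sq_norm (n := n)
    (b := 1 / 4) (by norm_num)).const_mul ((2 * π) ^ (-(n : ℝ) / 2) * Real.exp (L ^ 2)))
    (Continuous.aestronglyMeasurable ?_) (.of_forall fun x => ?_)
  · simp only [ENNReal.toReal_ofReal (stdGaussianDensity_pos _).le]
    have := continuous_stdGaussianDensity (n := n)
    fun_prop
  · rw [ENNReal.toReal_ofReal (stdGaussianDensity_pos x).le, Real.norm_of_nonneg
      (mul_nonneg (Real.exp_pos _).le (stdGaussianDensity_pos x).le), stdGaussianDensity,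
      mul_left_comm, mul_assoc, ← Real.exp_add, ← Real.exp_add]
    refine mul_le_mul_of_nonneg_left (Real.exp_le_exp.2 ?_) (by positivity)
    nlinarith [sq_nonneg (L - ‖x‖ / 2)]

theorem ofReal_exp_integral_le {α : Type*} [MeasurableSpace α] {μ : Measure α}
    [IsProbabilityMeasure μ] {u : α → ℝ} (hu : Integrable u μ) :
    ENNReal.ofReal (Real.exp (∫ x, u x ∂μ)) ≤ ∫⁻ x, ENNReal.ofReal (Real.exp (u x)) ∂μ := by
  by_cases he : Integrable (fun x => Real.exp (u x)) μ
  · rw [← ofReal_integral_eq_lintegral_ofReal he (.of_forall fun x => (Real.exp_pos _).le)]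
    exact ENNReal.ofReal_le_ofReal (convexOn_exp.map_integral_le Real.continuous_exp.continuousOn
      isClosed_univ (by simp) hu he)
  · have : ∫⁻ x, ENNReal.ofReal (Real.exp (u x)) ∂μ = ∞ := by
      by_contra hne
      refine he ⟨Real.continuous_exp.comp_aestronglyMeasurable hu.1, ?_⟩
      rw [hasFiniteIntegral_iff_ofReal (.of_forall fun x => (Real.exp_pos _).le)]
      exact lt_top_iff_ne_top.2 hne
    simp [this]

theorem lintegral_stdGaussian {g : EuclideanSpace ℝ (Fin n) → ℝ} (hg : Measurable g) :
    ∫⁻ x, ENNReal.ofReal (Real.exp (g x)) ∂(stdGaussian n)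
      = ∫⁻ x, ENNReal.ofReal (stdGaussianDensity n x * Real.exp (g x)) := by
  rw [stdGaussian_eq_withDensity, lintegral_withDensity_eq_lintegral_mul _
    measurable_ofReal_stdGaussianDensity hg.exp.ennreal_ofReal]
  simp [ENNReal.ofReal_mul (stdGaussianDensity_pos _).le]

/-- An exponential inequality of Tsirelson-Vitale type: the supremum of a Gaussian process with
half its variance subtracted is controlled by the mean of the supremum. -/
theorem lintegral_exp_inner_sub_le {T : EuclideanSpace ℝ (Fin n) → EuclideanSpace ℝ (Fin n)}
    {h : EuclideanSpace ℝ (Fin n) → ℝ} (mT : Measurable T) (mh : Measurable h)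
    (hT : ∀ x y, ⟪y, T x⟫ ≤ h y) (hh : Integrable h (stdGaussian n)) {s : ℝ} (hs : 0 < s)
    (hs1 : s < 1) :
    ∫⁻ x, ENNReal.ofReal (Real.exp (⟪x, T x⟫ - ‖T x‖ ^ 2 / (2 * (1 - s)))) ∂(stdGaussian n)
      ≤ ENNReal.ofReal (Real.exp (∫ y, h y ∂(stdGaussian n))) := by
  set D := ∫ y, h y ∂(stdGaussian n)
  have ht : 0 < 1 - s := sub_pos.2 hs1
  set p := fun x => ⟪x, T x⟫ - ‖T x‖ ^ 2 / (2 * (1 - s)) with hp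
  have mp : Measurable p := by fun_prop
  set q := fun y => -(s / (1 - s)) * h y with hq
  have mq : Measurable q := by fun_prop
  have mρ := measurable_ofReal_stdGaussianDensity (n := n)
  have pl := prekopa_leindler_euclideanSpace hs ht (by ring)
    (F := fun x => ENNReal.ofReal (stdGaussianDensity n x * Real.exp (p x)))
    (G := fun y => ENNReal.ofReal (stdGaussianDensity n y * Real.exp (q y)))
    (by have := continuous_stdGaussianDensity (n := n); fun_prop)
    (by have := continuous_stdGaussianDensity (n := n); fun_prop) mρ (by
      intro x y
      have hc : (0 : ℝ) < (2 * π) ^ (-(n : ℝ) / 2) := by positivity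
      have hx := stdGaussianDensity_pos x
      have hy := stdGaussianDensity_pos y
      rw [ENNReal.ofReal_rpow_of_pos (by positivity), ENNReal.ofReal_rpow_of_pos (by positivity),
        ← ENNReal.ofReal_mul (by positivity)]
      refine ENNReal.ofReal_le_ofReal ?_
      simp only [stdGaussianDensity, mul_assoc, ← Real.exp_add]
      rw [Real.mul_rpow hc.le (by positivity), Real.mul_rpow hc.le (by positivity),
        ← Real.exp_mul, ← Real.exp_mul, mul_mul_mul_comm, ← Real.rpow_add hc, ← Real.exp_add,
        add_sub_cancel, Real.rpow_one]
      gcongr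
      have e1 : ‖s • x + (1 - s) • y‖ ^ 2
          = s ^ 2 * ‖x‖ ^ 2 + 2 * (s * (1 - s)) * ⟪x, y⟫ + (1 - s) ^ 2 * ‖y‖ ^ 2 := by
        rw [norm_add_sq_real, norm_smul, norm_smul, inner_smul_left, inner_smul_right, mul_pow,
          mul_pow]
        simp
        ring
      have e2 : 0 ≤ ‖x - y - (1 - s)⁻¹ • T x‖ ^ 2 := sq_nonneg _
      rw [norm_sub_sq_real, norm_sub_sq_real, norm_smul, inner_smul_right, inner_sub_left, mul_pow,
        Real.norm_eq_abs, sq_abs] at e2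
      have e3 := hT x y
      have e4 : q y * (1 - s) = -s * h y := by
        simp only [hq]; field_simp
      have e5 : p x * s = s * ⟪x, T x⟫ - s * (1 - s) / 2 * ((1 - s)⁻¹ ^ 2 * ‖T x‖ ^ 2) := by
        simp only [hp]; field_simp
      have e6 : s * (1 - s) / 2 * (2 * ((1 - s)⁻¹ * (⟪x, T x⟫ - ⟪y, T x⟫)))
          = s * (⟪x, T x⟫ - ⟪y, T x⟫) := by field_simp
      have e7 := mul_nonneg (by positivity : 0 ≤ s * (1 - s) / 2) e2
      have e8 := mul_le_mul_of_nonneg_left e3 hs.le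
      rw [e1, add_mul, add_mul, e4, e5]
      linarith)
  rw [← lintegral_stdGaussian mp, ← lintegral_stdGaussian mq, lintegral_stdGaussianDensity] at pl
  have jensen := ofReal_exp_integral_le (hh.const_mul (-(s / (1 - s))))
  rw [integral_const_mul] at jensen
  set Z := ∫⁻ x, ENNReal.ofReal (Real.exp (p x)) ∂(stdGaussian n)
  have h1 : Z ^ s * ENNReal.ofReal (Real.exp (-(s * D))) ≤ 1 := by
    refine le_trans ?_ pl
    gcongr
    calc ENNReal.ofReal (Real.exp (-(s * D)))
        = ENNReal.ofReal (Real.exp (-(s / (1 - s)) * D)) ^ (1 - s) := by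
          rw [ENNReal.ofReal_rpow_of_pos (Real.exp_pos _), ← Real.exp_mul]
          congr 2
          field_simp
      _ ≤ _ := by gcongr
  rw [Real.exp_neg, ENNReal.ofReal_inv_of_pos (Real.exp_pos _), ← div_eq_mul_inv,
    ENNReal.div_le_iff (by simp [Real.exp_pos]) ENNReal.ofReal_ne_top, one_mul, mul_comm s,
    Real.exp_mul, ← ENNReal.ofReal_rpow_of_pos (Real.exp_pos _)] at h1
  exact (ENNReal.rpow_le_rpow_iff hs).1 h1

/-- The Gibbs variational principle. -/
theorem integral_le_of_lintegral_exp_le {α : Type*} [MeasurableSpace α] {μ : Measure α}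
    {f g : α → ℝ} {D : ℝ} (mf : Measurable f) (mg : Measurable g)
    [IsProbabilityMeasure (μ.withDensity fun x => ENNReal.ofReal (Real.exp (f x)))]
    (hf : Integrable f (μ.withDensity fun x => ENNReal.ofReal (Real.exp (f x))))
    (hg : Integrable g (μ.withDensity fun x => ENNReal.ofReal (Real.exp (f x))))
    (h : ∫⁻ x, ENNReal.ofReal (Real.exp (g x)) ∂μ ≤ ENNReal.ofReal (Real.exp D)) :
    ∫ x, g x ∂(μ.withDensity fun x => ENNReal.ofReal (Real.exp (f x)))
      ≤ ∫ x, f x ∂(μ.withDensity fun x => ENNReal.ofReal (Real.exp (f x))) + D := by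
  have jensen := ofReal_exp_integral_le (hg.sub hf)
  rw [lintegral_withDensity_eq_lintegral_mul _ mf.exp.ennreal_ofReal
    (by fun_prop)] at jensen
  simp only [Pi.mul_apply, Pi.sub_apply, ← ENNReal.ofReal_mul (Real.exp_pos _).le, ← Real.exp_add,
    add_sub_cancel] at jensen
  have := (ENNReal.ofReal_le_ofReal_iff (Real.exp_pos _).le).1 (jensen.trans h)
  rw [Real.exp_le_exp, integral_sub hg hf] at this
  linarith

theorem contDiff_gradient {f : EuclideanSpace ℝ (Fin n) → ℝ} (hf : ContDiff ℝ 2 f) :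
    ContDiff ℝ 1 (gradient f) :=
  (InnerProductSpace.toDual ℝ (EuclideanSpace ℝ (Fin n))).symm.contDiff.comp
    (hf.fderiv_right (m := 1) (by norm_num))

theorem integral_mul_lap {a f : EuclideanSpace ℝ (Fin n) → ℝ} (ha : ContDiff ℝ 1 a)
    (hc : HasCompactSupport a) (hf : ContDiff ℝ 2 f) :
    ∫ x, a x * lap f x = -∫ x, fderiv ℝ a x (gradient f x) := by
  have hg := contDiff_gradient hf
  have hgc := hg.continuous_fderiv one_ne_zero
  have hac := ha.continuous_fderiv one_ne_zero
  have hdc := hc.fderiv ℝ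
  let e : Fin n → EuclideanSpace ℝ (Fin n) := fun i => EuclideanSpace.single i 1
  have hgi : ∀ i x, fderiv ℝ (fun y => gradient f y i) x (e i)
      = fderiv ℝ (gradient f) x (e i) i := by
    intro i x
    have h := ((EuclideanSpace.proj i : EuclideanSpace ℝ (Fin n) →L[ℝ] ℝ).hasFDerivAt.comp x
      (hg.differentiable one_ne_zero x).hasFDerivAt).fderiv
    simpa [Function.comp_def] using DFunLike.congr_fun h (e i)
  have int1 : ∀ i, Integrable fun x => a x * fderiv ℝ (gradient f) x (e i) i := fun i =>
    Continuous.integrable_of_hasCompactSupport (by have := ha.continuous; fun_prop) hc.mul_right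
  have int2 : ∀ i, Integrable fun x => fderiv ℝ a x (e i) * gradient f x i := fun i =>
    Continuous.integrable_of_hasCompactSupport (by have := hg.continuous; fun_prop)
      (HasCompactSupport.mul_right (f := fun x => fderiv ℝ a x (e i))
        (hdc.comp_left (g := fun l : EuclideanSpace ℝ (Fin n) →L[ℝ] ℝ => l (e i)) (by simp)))
  have hdecomp : ∀ x, fderiv ℝ a x (gradient f x) = ∑ i, fderiv ℝ a x (e i) * gradient f x i := by
    intro x
    conv_lhs => rw [← (EuclideanSpace.basisFun (Fin n) ℝ).sum_repr (gradient f x)]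
    simp [e, mul_comm]
  have hparts : ∀ i, ∫ x, a x * fderiv ℝ (gradient f) x (e i) i
      = -∫ x, fderiv ℝ a x (e i) * gradient f x i := by
    intro i
    simp only [← hgi]
    refine integral_mul_fderiv_eq_neg_fderiv_mul_of_integrable (int2 i)
      (by simpa only [hgi] using int1 i)
      (Continuous.integrable_of_hasCompactSupport
        (by have := ha.continuous; have := hg.continuous; fun_prop) hc.mul_right)
      (fun x _ => ha.differentiable one_ne_zero x) (fun x _ => ?_)
    have := hg.differentiable one_ne_zero
    fun_prop
  simp only [hdecomp, lap, Finset.mul_sum]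
  rw [integral_finsetSum _ fun i _ => int1 i, integral_finsetSum _ fun i _ => int2 i,
    ← Finset.sum_neg_distrib]
  exact Finset.sum_congr rfl fun i _ => hparts i

theorem hasFDerivAt_stdGaussianDensity (x : EuclideanSpace ℝ (Fin n)) :
    HasFDerivAt (stdGaussianDensity n) (-stdGaussianDensity n x • innerSL ℝ x) x := by
  have h := ((((hasStrictFDerivAt_norm_sq x).hasFDerivAt.const_mul (-1 / 2 : ℝ))).exp).const_mul
    ((2 * π) ^ (-(n : ℝ) / 2))
  convert! h using 1
  · ext y
    simp only [stdGaussianDensity]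
    ring_nf
  · ext v
    simp [stdGaussianDensity]
    ring_nf

theorem contDiff_stdGaussianDensity {m : WithTop ℕ∞} : ContDiff ℝ m (stdGaussianDensity n) :=
  contDiff_const.mul (((contDiff_norm_sq ℝ).neg.div_const 2).exp)

theorem withDensity_stdGaussian {f : EuclideanSpace ℝ (Fin n) → ℝ} (hf : Measurable f) :
    (stdGaussian n).withDensity (fun x => ENNReal.ofReal (Real.exp (f x)))
      = volume.withDensity
        fun x => ENNReal.ofReal (stdGaussianDensity n x * Real.exp (f x)) := by
  rw [stdGaussian_eq_withDensity, ← withDensity_mul _ measurable_ofReal_stdGaussianDensity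
    hf.exp.ennreal_ofReal]
  congr 1
  ext x
  simp [ENNReal.ofReal_mul (stdGaussianDensity_pos _).le]

theorem integral_withDensity_stdGaussian {f : EuclideanSpace ℝ (Fin n) → ℝ} (hf : Measurable f)
    (u : EuclideanSpace ℝ (Fin n) → ℝ) :
    ∫ x, u x ∂(stdGaussian n).withDensity (fun x => ENNReal.ofReal (Real.exp (f x)))
      = ∫ x, stdGaussianDensity n x * Real.exp (f x) * u x := by
  rw [withDensity_stdGaussian hf, integral_withDensity_eq_integral_toReal_smul
    (by have := continuous_stdGaussianDensity (n := n); fun_prop) (by simp)]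
  refine integral_congr_ae (.of_forall fun x => ?_)
  have := stdGaussianDensity_pos x
  simp only [smul_eq_mul]
  rw [ENNReal.toReal_ofReal (by positivity)]

theorem continuous_lap {f : EuclideanSpace ℝ (Fin n) → ℝ} (hf : ContDiff ℝ 2 f) :
    Continuous (lap f) := by
  have := (contDiff_gradient hf).continuous_fderiv one_ne_zero
  unfold lap
  fun_prop

/-- Gaussian integration by parts against a compactly supported test function. -/
theorem integral_mul_lap_add_withDensity {φ f : EuclideanSpace ℝ (Fin n) → ℝ}
    (hφ : ContDiff ℝ 1 φ) (hc : HasCompactSupport φ) (hf : ContDiff ℝ 2 f) :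
    ∫ x, φ x * (lap f x + ‖gradient f x‖ ^ 2 - ⟪x, gradient f x⟫)
        ∂(stdGaussian n).withDensity (fun x => ENNReal.ofReal (Real.exp (f x)))
      = -∫ x, fderiv ℝ φ x (gradient f x)
        ∂(stdGaussian n).withDensity (fun x => ENNReal.ofReal (Real.exp (f x))) := by
  have mf := hf.continuous.measurable
  have hf1 : ContDiff ℝ 1 f := hf.of_le (by norm_num)
  set w := fun x => stdGaussianDensity n x * Real.exp (f x) with hw
  have cw : ContDiff ℝ 1 w := contDiff_stdGaussianDensity.mul hf1.exp
  have dw : ∀ x v, fderiv ℝ w x v = w x * (⟪gradient f x, v⟫ - ⟪x, v⟫) := by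
    intro x v
    have h : HasFDerivAt w _ x := (hasFDerivAt_stdGaussianDensity x).mul
      (hf1.differentiable one_ne_zero x).hasFDerivAt.exp
    rw [h.fderiv]
    simp [hw]
    ring
  have da : ∀ x, fderiv ℝ (fun x => w x * φ x) x (gradient f x)
      = w x * (φ x * (‖gradient f x‖ ^ 2 - ⟪x, gradient f x⟫))
        + w x * fderiv ℝ φ x (gradient f x) := by
    intro x
    have h : HasFDerivAt (fun x => w x * φ x) _ x :=
      (cw.differentiable one_ne_zero x).hasFDerivAt.mul
        (hφ.differentiable one_ne_zero x).hasFDerivAt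
    rw [h.fderiv]
    simp [dw]
    ring
  have key := integral_mul_lap (a := fun x => w x * φ x) (cw.mul hφ) hc.mul_left hf
  have hgc := (contDiff_gradient hf).continuous
  have hwc := cw.continuous
  have hφc := hφ.continuous
  have hlap := continuous_lap hf
  have hdφ := hφ.continuous_fderiv one_ne_zero
  have i1 : Integrable fun x => w x * (φ x * (‖gradient f x‖ ^ 2 - ⟪x, gradient f x⟫)) :=
    Continuous.integrable_of_hasCompactSupport (by fun_prop) hc.mul_right.mul_left
  have i2 : Integrable fun x => w x * fderiv ℝ φ x (gradient f x) := by
    refine Continuous.integrable_of_hasCompactSupport (by fun_prop) (HasCompactSupport.mul_left ?_)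
    exact (hc.fderiv ℝ).mono fun x hx h => hx (by simp [h])
  have i3 : Integrable fun x => w x * φ x * lap f x :=
    Continuous.integrable_of_hasCompactSupport (by fun_prop) hc.mul_left.mul_right
  simp only [da] at key
  rw [integral_add i1 i2] at key
  rw [integral_withDensity_stdGaussian mf, integral_withDensity_stdGaussian mf]
  calc _ = ∫ x, (w x * φ x * lap f x
        + w x * (φ x * (‖gradient f x‖ ^ 2 - ⟪x, gradient f x⟫))) := by
        congr 1 with x
        simp only [hw]
        ring
    _ = _ := by
        rw [integral_add i3 i1, key]
        simp only [hw]
        ring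

/-- An upper bound for the Fisher information when the Laplacian is bounded below. -/
theorem integral_norm_gradient_sq_le {f : EuclideanSpace ℝ (Fin n) → ℝ} {L M : ℝ}
    (hf : ContDiff ℝ 2 f) (hL : ∀ x, ‖gradient f x‖ ≤ L) (hM : ∀ x, -M ≤ lap f x)
    {ν : Measure (EuclideanSpace ℝ (Fin n))} [IsProbabilityMeasure ν]
    (hν : ν = (stdGaussian n).withDensity fun x => ENNReal.ofReal (Real.exp (f x)))
    (hi : Integrable (fun x => ‖gradient f x‖ ^ 2) ν)
    (hx : Integrable (fun x => ⟪x, gradient f x⟫) ν) :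
    ∫ x, ‖gradient f x‖ ^ 2 ∂ν ≤ M + ∫ x, ⟪x, gradient f x⟫ ∂ν := by
  let b : ContDiffBump (0 : EuclideanSpace ℝ (Fin n)) := ⟨1, 2, one_pos, one_lt_two⟩
  have hb : ContDiff ℝ 1 b := b.contDiff
  have hbc : HasCompactSupport b := b.hasCompactSupport
  obtain ⟨C, hC⟩ := (hbc.fderiv ℝ).exists_bound_of_continuous (hb.continuous_fderiv one_ne_zero)
  let r : ℕ → ℝ := fun k => 1 / ((k : ℝ) + 1)
  have hr : ∀ k, 0 < r k := fun k => Nat.one_div_pos_of_nat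
  let φ : ℕ → EuclideanSpace ℝ (Fin n) → ℝ := fun k x => b (r k • x)
  have hφ : ∀ k, ContDiff ℝ 1 (φ k) := fun k => hb.comp (contDiff_id.const_smul (r k))
  have hφc : ∀ k, HasCompactSupport (φ k) := fun k => hbc.comp_smul (hr k).ne'
  have hdφ : ∀ k x v, fderiv ℝ (φ k) x v = r k * fderiv ℝ b (r k • x) v := by
    intro k x v
    have h := ((hb.differentiable one_ne_zero (r k • x)).hasFDerivAt.comp x
      ((hasFDerivAt_id x).const_smul (r k))).fderiv
    have := DFunLike.congr_fun h v
    simpa [Function.comp_def, φ] using this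
  set u := fun x => ‖gradient f x‖ ^ 2 - ⟪x, gradient f x⟫ - M with hu
  have iu : Integrable u ν := (hi.sub hx).sub (integrable_const M)
  have hgc := (contDiff_gradient hf).continuous
  have hbound : ∀ k, ∫ x, φ k x * u x ∂ν ≤ r k * (C * L) := by
    intro k
    have hk := (hφ k).continuous
    calc ∫ x, φ k x * u x ∂ν
        ≤ ∫ x, φ k x * (lap f x + ‖gradient f x‖ ^ 2 - ⟪x, gradient f x⟫) ∂ν := by
          refine integral_mono
            (Continuous.integrable_of_hasCompactSupport (by fun_prop) (hφc k).mul_right)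
            (Continuous.integrable_of_hasCompactSupport
              (by have := continuous_lap hf; fun_prop) (hφc k).mul_right) fun x => ?_
          refine mul_le_mul_of_nonneg_left ?_ b.nonneg
          simp only [hu]
          linarith [hM x]
      _ = -∫ x, fderiv ℝ (φ k) x (gradient f x) ∂ν := by
          rw [hν]
          exact integral_mul_lap_add_withDensity (hφ k) (hφc k) hf
      _ ≤ ‖∫ x, fderiv ℝ (φ k) x (gradient f x) ∂ν‖ := neg_le_abs _
      _ ≤ r k * (C * L) * ν.real Set.univ := by
          refine norm_integral_le_of_norm_le_const (.of_forall fun x => ?_)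
          rw [hdφ, norm_mul, Real.norm_of_nonneg (hr k).le]
          exact mul_le_mul_of_nonneg_left (ContinuousLinearMap.le_of_opNorm_le_of_le _ (hC _)
            (hL x)) (hr k).le
      _ = r k * (C * L) := by simp
  have hr0 : Filter.Tendsto r Filter.atTop (nhds 0) := tendsto_one_div_add_atTop_nhds_zero_nat
  have hlim : Filter.Tendsto (fun k => ∫ x, φ k x * u x ∂ν) Filter.atTop (nhds (∫ x, u x ∂ν)) := by
    refine tendsto_integral_of_dominated_convergence (fun x => ‖u x‖)
      (fun k => (hφ k).continuous.aestronglyMeasurable.mul iu.1) iu.norm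
      (fun k => .of_forall fun x => ?_) (.of_forall fun x => ?_)
    · rw [norm_mul, Real.norm_of_nonneg b.nonneg]
      exact mul_le_of_le_one_left (norm_nonneg _) b.le_one
    · have h1 : Filter.Tendsto (fun k => r k • x) Filter.atTop (nhds 0) := by
        simpa using hr0.smul_const x
      have h2 : Filter.Tendsto (fun k => φ k x) Filter.atTop (nhds 1) := by
        have := (hb.continuous.tendsto 0).comp h1
        rwa [b.one_of_mem_closedBall (by simp [b])] at this
      simpa using h2.mul_const (u x)
  have hle : ∫ x, u x ∂ν ≤ 0 :=
    le_of_tendsto_of_tendsto' hlim (by simpa using hr0.mul_const (C * L)) hbound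
  have hsplit : ∫ x, u x ∂ν
      = ∫ x, ‖gradient f x‖ ^ 2 ∂ν - ∫ x, ⟪x, gradient f x⟫ ∂ν - M := by
    simp only [hu]
    rw [integral_sub (f := fun x => ‖gradient f x‖ ^ 2 - ⟪x, gradient f x⟫) (hi.sub hx)
      (integrable_const M), integral_sub hi hx]
    simp
  linarith

theorem exists_bound_of_forall_bddAbove_inner {ι : Type*} {T : ι → EuclideanSpace ℝ (Fin n)}
    (h : ∀ y, ∃ C, ∀ i, ⟪y, T i⟫ ≤ C) : ∃ L, ∀ i, ‖T i‖ ≤ L := by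
  obtain ⟨L, hL⟩ := banach_steinhaus (g := fun i => innerSL ℝ (T i)) fun y => by
    obtain ⟨C, hC⟩ := h y
    obtain ⟨C', hC'⟩ := h (-y)
    refine ⟨max C C', fun i => abs_le'.2 ⟨?_, ?_⟩⟩
    · simpa [real_inner_comm] using Or.inl (hC i)
    · simpa [real_inner_comm] using Or.inr (hC' i)
  exact ⟨L, fun i => by simpa using hL i⟩

theorem le_add_mul_norm_of_norm_gradient_le {f : EuclideanSpace ℝ (Fin n) → ℝ} {L : ℝ}
    (hf : Differentiable ℝ f) (hL : ∀ x, ‖gradient f x‖ ≤ L) (x : EuclideanSpace ℝ (Fin n)) :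
    f x ≤ f 0 + L * ‖x‖ := by
  have := convex_univ.norm_image_sub_le_of_norm_fderiv_le (f := f) (fun x _ => hf x)
    (fun x _ => (by simpa [gradient] using hL x : ‖fderiv ℝ f x‖ ≤ L))
    (Set.mem_univ 0) (Set.mem_univ x)
  rw [sub_zero] at this
  linarith [le_abs_self (f x - f 0), Real.norm_eq_abs (f x - f 0)]

theorem integrable_norm_withDensity {f : EuclideanSpace ℝ (Fin n) → ℝ} {L : ℝ}
    (hf : Differentiable ℝ f) (hL : ∀ x, ‖gradient f x‖ ≤ L) :
    Integrable (fun x => ‖x‖)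
      ((stdGaussian n).withDensity fun x => ENNReal.ofReal (Real.exp (f x))) := by
  have hfc := hf.continuous
  rw [integrable_withDensity_iff (by fun_prop) (by simp)]
  simp only [ENNReal.toReal_ofReal (Real.exp_pos _).le]
  refine Integrable.mono' ((integrable_exp_mul_norm_stdGaussian (1 + L)).const_mul
    (Real.exp (f 0))) (Continuous.aestronglyMeasurable (by fun_prop)) (.of_forall fun x => ?_)
  rw [Real.norm_of_nonneg (by positivity), ← Real.exp_add]
  calc ‖x‖ * Real.exp (f x) ≤ Real.exp ‖x‖ * Real.exp (f 0 + L * ‖x‖) := by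
        gcongr
        · linarith [Real.add_one_le_exp ‖x‖]
        · exact le_add_mul_norm_of_norm_gradient_le hf hL x
    _ = _ := by
        rw [← Real.exp_add]
        ring_nf

end Gaussian

theorem reverse_log_sobolev (n : ℕ)
    (f : EuclideanSpace ℝ (Fin n) → ℝ) (ν : Measure (EuclideanSpace ℝ (Fin n))) (M : ℝ)
    (hf : ContDiff ℝ 2 f)
    (hν : ν = (stdGaussian n).withDensity fun x => ENNReal.ofReal (Real.exp (f x)))
    (hprob : IsProbabilityMeasure ν)
    (hent : Integrable f ν)
    (hfish : Integrable (fun x => ‖gradient f x‖ ^ 2) ν)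
    (hbdd : ∀ y : EuclideanSpace ℝ (Fin n),
      BddAbove (Set.range fun t : Set.range (gradient f) =>
        ⟪y, (t : EuclideanSpace ℝ (Fin n))⟫))
    (hD : Integrable (gaussWidthFn (Set.range (gradient f))) (stdGaussian n))
    (hM : IsGLB (Set.range (lap f)) (-M)) :
    (1 / 2) * ∫ x, ‖gradient f x‖ ^ 2 ∂ν
      ≤ ∫ x, f x ∂ν + M
        + ∫ y, gaussWidthFn (Set.range (gradient f)) y ∂(stdGaussian n) := by
  set h := gaussWidthFn (Set.range (gradient f)) with hh
  have hle : ∀ x y, ⟪y, gradient f x⟫ ≤ h y := fun x y =>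
    le_ciSup (hbdd y) ⟨gradient f x, Set.mem_range_self x⟩
  have mh : Measurable h := by
    refine (lowerSemicontinuous_ciSup hbdd fun t => ?_).measurable
    exact (continuous_id.inner continuous_const).lowerSemicontinuous
  obtain ⟨L, hL⟩ := exists_bound_of_forall_bddAbove_inner (T := gradient f)
    fun y => ⟨h y, fun x => hle x y⟩
  have hdf : Differentiable ℝ f := hf.differentiable two_ne_zero
  have hgc := (contDiff_gradient hf).continuous
  have hx : Integrable (fun x => ⟪x, gradient f x⟫) ν := by
    have hnorm := integrable_norm_withDensity hdf hL
    rw [← hν] at hnorm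
    refine (hnorm.mul_const L).mono' (Continuous.aestronglyMeasurable (by fun_prop))
      (.of_forall fun x => (norm_inner_le_norm _ _).trans ?_)
    exact mul_le_mul_of_nonneg_left (hL x) (norm_nonneg x)
  have hI := integral_norm_gradient_sq_le hf hL (fun x => hM.1 (Set.mem_range_self x)) hν hfish hx
  set I := ∫ x, ‖gradient f x‖ ^ 2 ∂ν
  set J := ∫ x, ⟪x, gradient f x⟫ ∂ν with hJ
  have hs : ∀ s ∈ Set.Ioo (0 : ℝ) 1, J - I / (2 * (1 - s)) ≤ ∫ x, f x ∂ν
      + ∫ y, h y ∂(stdGaussian n) := by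
    intro s hs
    have hint : Integrable (fun x => ⟪x, gradient f x⟫ - ‖gradient f x‖ ^ 2 / (2 * (1 - s))) ν :=
      hx.sub (hfish.div_const _)
    have hexp := lintegral_exp_inner_sub_le hgc.measurable mh hle hD hs.1 hs.2
    have hsub : ∫ x, (⟪x, gradient f x⟫ - ‖gradient f x‖ ^ 2 / (2 * (1 - s))) ∂ν
        = J - I / (2 * (1 - s)) := by
      rw [integral_sub hx (hfish.div_const _), integral_div]
    rw [← hsub]
    subst hν
    exact integral_le_of_lintegral_exp_le hf.continuous.measurable (by fun_prop) hent hint hexp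
  have hlim : Filter.Tendsto (fun s : ℝ => J - I / (2 * (1 - s))) (nhdsWithin 0 (Set.Ioi 0))
      (nhds (J - I / (2 * (1 - 0)))) := by
    refine (ContinuousAt.tendsto ?_).mono_left nhdsWithin_le_nhds
    exact continuousAt_const.sub (continuousAt_const.div (by fun_prop) (by norm_num))
  have hfin := le_of_tendsto hlim
    (Filter.mem_of_superset (Ioo_mem_nhdsGT one_pos) hs)
  linarith
end

section
/- Let γ be the standard Gaussian measure on ℝⁿ and K ⊆ ℝⁿ a set such that x ↦ sup_{t∈K} ⟨x, t⟩ is γ-integrable. Define Z(x) = sup_{t∈K} [⟨x, t⟩ − |t|²/2]. Then ∫ e^{Z} dγ ≤ exp(∫ sup_{t∈K} ⟨x, t⟩ dγ(x)). -/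
open MeasureTheory Real
open scoped RealInnerProductSpace ENNReal

section

open ProbabilityTheory Filter Topology Set
open scoped NNReal

lemma continuous_gaussianPDFReal (μ : ℝ) (v : ℝ≥0) : Continuous (gaussianPDFReal μ v) := by
  unfold gaussianPDFReal
  fun_prop

lemma hasDerivAt_gaussianPDFReal_standard (y : ℝ) :
    HasDerivAt (gaussianPDFReal 0 1) (-y * gaussianPDFReal 0 1 y) y := by
  have h : HasDerivAt (fun x : ℝ => -(x - 0) ^ 2 / (2 * ((1 : ℝ≥0) : ℝ))) (-y) y := by
    have := ((hasDerivAt_id y).pow 2).neg.div_const 2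
    convert! this using 1
    · ext x; simp
    · simp; ring
  have h2 := h.exp.const_mul ((√(2 * π * ((1 : ℝ≥0) : ℝ)))⁻¹)
  rw [gaussianPDFReal_def]
  convert! h2 using 1
  ring

lemma gaussianPDFReal_standard_le_one (y : ℝ) : gaussianPDFReal 0 1 y ≤ 1 := by
  unfold gaussianPDFReal
  have h1 : (√(2 * π * ((1 : ℝ≥0) : ℝ)))⁻¹ ≤ 1 := by
    apply inv_le_one_of_one_le₀
    rw [Real.one_le_sqrt]
    have := Real.pi_gt_three
    simp
    linarith
  have h2 : rexp (-(y - 0) ^ 2 / (2 * ((1 : ℝ≥0) : ℝ))) ≤ 1 := by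
    rw [Real.exp_le_one_iff]
    have := sq_nonneg y
    simp
    linarith
  exact mul_le_one₀ h1 (exp_pos _).le h2

lemma integrable_gaussianReal_iff {f : ℝ → ℝ} :
    Integrable f (gaussianReal 0 1) ↔
      Integrable (fun x => gaussianPDFReal 0 1 x * f x) volume := by
  rw [gaussianReal_of_var_ne_zero _ one_ne_zero,
    integrable_withDensity_iff_integrable_smul' (measurable_gaussianPDF _ _)
      (ae_of_all _ fun _ => gaussianPDF_lt_top)]
  simp

/-- Gaussian integration by parts for a bounded function with bounded derivative. -/
lemma integral_deriv_sub_mul_gaussianReal {T T' : ℝ → ℝ} {C : ℝ} (hT : ∀ y, HasDerivAt T (T' y) y)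
    (hT'm : AEStronglyMeasurable T' (gaussianReal 0 1)) (hC : ∀ y, ‖T y‖ ≤ C)
    (hC' : ∀ y, ‖T' y‖ ≤ C) :
    Integrable (fun y => T' y - y * T y) (gaussianReal 0 1) ∧
      ∫ y, (T' y - y * T y) ∂(gaussianReal 0 1) = 0 := by
  have hTc : Continuous T := continuous_iff_continuousAt.2 fun y => (hT y).continuousAt
  have iT : Integrable T (gaussianReal 0 1) :=
    Integrable.of_bound hTc.aestronglyMeasurable C (ae_of_all _ hC)
  have iT' : Integrable T' (gaussianReal 0 1) :=
    Integrable.of_bound hT'm C (ae_of_all _ hC')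
  have iid : Integrable (fun y : ℝ => y) (gaussianReal 0 1) :=
    memLp_one_iff_integrable.1 (memLp_id_gaussianReal 1)
  have iyT : Integrable (fun y => y * T y) (gaussianReal 0 1) :=
    iid.mul_bdd hTc.aestronglyMeasurable (ae_of_all _ hC)
  refine ⟨iT'.sub iyT, ?_⟩
  rw [integral_gaussianReal_eq_integral_smul one_ne_zero]
  refine integral_eq_zero_of_hasDerivAt_of_integrable (f := fun y => gaussianPDFReal 0 1 y * T y)
    (fun y => ?_) (integrable_gaussianReal_iff.1 (iT'.sub iyT)) (integrable_gaussianReal_iff.1 iT)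
  convert! (hasDerivAt_gaussianPDFReal_standard y).mul (hT y) using 1
  simp only [smul_eq_mul]
  ring

lemma integral_sq_gaussianReal :
    Integrable (fun y : ℝ => y ^ 2) (gaussianReal 0 1) ∧
      ∫ y : ℝ, y ^ 2 ∂(gaussianReal 0 1) = 1 := by
  refine ⟨(memLp_id_gaussianReal 2).integrable_sq, ?_⟩
  have := variance_fun_id_gaussianReal (μ := 0) (v := 1)
  rw [variance_of_integral_eq_zero (by fun_prop) (by simp)] at this
  simpa using this

/-- A continuous solution `T` of `G ∘ T = v` is differentiable where `G` has nonzero strict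
derivative. -/
lemma HasStrictDerivAt.hasDerivAt_of_comp_eq {G T v : ℝ → ℝ} {g v' y : ℝ}
    (hG : HasStrictDerivAt G g (T y)) (hg : g ≠ 0) (hT : ContinuousAt T y)
    (hv : HasDerivAt v v' y) (h : ∀ z, G (T z) = v z) : HasDerivAt T (g⁻¹ * v') y := by
  have h1 := (hG.to_localInverse hg).hasDerivAt
  rw [h y] at h1
  refine (h1.comp y hv).congr_of_eventuallyEq ?_
  have h2 := hG.hasStrictFDerivAt_equiv hg
  have h3 := hT.eventually h2.eventually_left_inverse
  filter_upwards [h3] with z hz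
  simp only [Function.comp, ← h z]
  exact hz.symm

lemma intervalIntegral_exp_gaussianReal_le {φ f : ℝ → ℝ} (hφ : Continuous φ)
    (hf : Integrable f (gaussianReal 0 1)) (h : ∀ x y, φ x ≤ f y + (x - y) ^ 2 / 2)
    {R : ℝ} (hR : 0 < R) :
    ∫ x in (-R)..R, gaussianPDFReal 0 1 x * rexp (φ x) ≤
      rexp (∫ y, f y ∂(gaussianReal 0 1)) := by
  set g := gaussianPDFReal 0 1 with hg
  have gpos : ∀ x, 0 < g x := fun x => gaussianPDFReal_pos 0 1 x one_ne_zero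
  have gc : Continuous g := continuous_gaussianPDFReal 0 1
  have gi : Integrable g := integrable_gaussianPDFReal 0 1
  set w : ℝ → ℝ := fun x => g x * rexp (φ x) with hw
  have wc : Continuous w := by fun_prop
  have wpos : ∀ x, 0 < w x := fun x => mul_pos (gpos x) (exp_pos _)
  set G : ℝ → ℝ := fun x => ∫ t in (-R)..x, w t with hGdef
  have hG : ∀ x, HasStrictDerivAt G (w x) x := fun x => wc.integral_hasStrictDerivAt _ x
  have Gc : Continuous G := continuous_iff_continuousAt.2 fun y => (hG y).hasDerivAt.continuousAt
  have Gm : StrictMono G := strictMono_of_hasDerivAt_pos (fun x => (hG x).hasDerivAt) wpos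
  set m := G R with hm
  have G0 : G (-R) = 0 := by simp [hGdef]
  have mpos : 0 < m := by rw [← G0]; exact Gm (by linarith)
  set Γ : ℝ → ℝ := fun y => ∫ x in Iic y, g x with hΓ
  have Γd : ∀ y, HasDerivAt Γ (g y) y := by
    intro y
    have : Γ = fun y => Γ 0 + ∫ x in (0 : ℝ)..y, g x := by
      ext y
      rw [← intervalIntegral.integral_Iic_sub_Iic gi.integrableOn gi.integrableOn]
      simp [hΓ]
    rw [this]
    exact (gc.integral_hasStrictDerivAt 0 y).hasDerivAt.const_add _
  have Γ0 : ∀ y, 0 ≤ Γ y := fun y => integral_nonneg fun x => (gpos x).le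
  have Γ1 : ∀ y, Γ y ≤ 1 := fun y =>
    (setIntegral_le_integral gi (ae_of_all _ fun x => (gpos x).le)).trans_eq
      (integral_gaussianPDFReal_eq_one 0 one_ne_zero)
  have hex : ∀ y, ∃ t ∈ Icc (-R) R, G t = m * Γ y := by
    intro y
    apply intermediate_value_Icc (by linarith) Gc.continuousOn
    rw [G0]
    exact ⟨mul_nonneg mpos.le (Γ0 y), mul_le_of_le_one_right mpos.le (Γ1 y)⟩
  choose T hTR hTG using hex
  have vd : ∀ y, HasDerivAt (fun y => m * Γ y) (m * g y) y := fun y => (Γd y).const_mul m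
  have Tc : Continuous T := by
    have hemb : IsEmbedding G :=
      Gm.isEmbedding_of_ordConnected (isPreconnected_range Gc).ordConnected
    rw [hemb.continuous_iff]
    have : G ∘ T = fun y => m * Γ y := funext hTG
    rw [this]
    exact continuous_iff_continuousAt.2 fun y => (vd y).continuousAt
  set T' : ℝ → ℝ := fun y => (w (T y))⁻¹ * (m * g y) with hT'
  have Td : ∀ y, HasDerivAt T (T' y) y := fun y =>
    (hG (T y)).hasDerivAt_of_comp_eq (wpos _).ne' Tc.continuousAt (vd y) hTG
  have T'pos : ∀ y, 0 < T' y := fun y =>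
    mul_pos (inv_pos.2 (wpos _)) (mul_pos mpos (gpos y))
  have T'c : Continuous T' := by
    refine Continuous.mul (Continuous.inv₀ (wc.comp Tc) fun y => (wpos _).ne') (by fun_prop)
  obtain ⟨x₀, -, hx₀⟩ := isCompact_Icc.exists_isMinOn (nonempty_Icc.2 (by linarith : -R ≤ R))
    wc.continuousOn
  have T'b : ∀ y, T' y ≤ (w x₀)⁻¹ * (m * 1) := by
    intro y
    have h1 : w x₀ ≤ w (T y) := hx₀ (hTR y)
    have h2 := wpos x₀
    have h3 := (gpos y).le
    have h4 : g y ≤ 1 := gaussianPDFReal_standard_le_one y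
    simp only [hT']
    gcongr
  obtain ⟨i1, e1⟩ := integral_deriv_sub_mul_gaussianReal (C := max R ((w x₀)⁻¹ * (m * 1))) Td
    T'c.aestronglyMeasurable
    (fun y => (abs_le.2 (hTR y)).trans (le_max_left _ _))
    (fun y => by
      rw [Real.norm_of_nonneg (T'pos y).le]
      exact (T'b y).trans (le_max_right _ _))
  obtain ⟨i2, e2⟩ := integral_sq_gaussianReal
  have key : ∀ y, log m ≤ (f y + (y ^ 2 - 1)) + (T' y - y * T y) := by
    intro y
    have hmT : m * g y = T' y * (g (T y) * rexp (φ (T y))) := by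
      simp only [hT', hw]
      field_simp [(gpos (T y)).ne']
    have hlog := congrArg log hmT
    have lg : ∀ x, log (g x) = log ((√(2 * π * ((1 : ℝ≥0) : ℝ)))⁻¹) - x ^ 2 / 2 := by
      intro x
      simp only [hg, gaussianPDFReal]
      rw [log_mul (by positivity) (exp_pos _).ne', log_exp]
      simp
      ring
    rw [log_mul mpos.ne' (gpos y).ne', log_mul (T'pos y).ne' (wpos _).ne',
      log_mul (gpos _).ne' (exp_pos _).ne', log_exp, lg, lg] at hlog
    have h1 := log_le_sub_one_of_pos (T'pos y)
    have h2 := h (T y) y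
    nlinarith
  rw [← log_le_iff_le_exp mpos]
  have ic : Integrable (fun _ : ℝ => (1 : ℝ)) (gaussianReal 0 1) := integrable_const _
  calc log m = ∫ _, log m ∂(gaussianReal 0 1) := by simp
    _ ≤ ∫ y, ((f y + (y ^ 2 - 1)) + (T' y - y * T y)) ∂(gaussianReal 0 1) :=
        integral_mono (integrable_const _) ((hf.add (i2.sub ic)).add i1) key
    _ = ∫ y, f y ∂(gaussianReal 0 1) := by
        have e3 := integral_add (hf.add (i2.sub ic)) i1
        have e4 := integral_add hf (i2.sub ic)
        have e5 := integral_sub i2 ic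
        simp only [Pi.add_apply, Pi.sub_apply] at e3 e4 e5
        rw [e3, e1, e4, e5, e2]
        simp

lemma LipschitzWith.ciSup {ι α : Type*} [PseudoMetricSpace α] [Nonempty ι] {g : ι → α → ℝ}
    {C : ℝ≥0} (hg : ∀ i, LipschitzWith C (g i)) (hb : ∀ x, BddAbove (range fun i => g i x)) :
    LipschitzWith C fun x => ⨆ i, g i x :=
  LipschitzWith.of_le_add_mul C fun x y => ciSup_le fun i =>
    ((hg i).le_add_mul x y).trans (by gcongr; exact le_ciSup (hb y) i)

lemma LipschitzWith.ciInf {ι α : Type*} [PseudoMetricSpace α] [Nonempty ι] {g : ι → α → ℝ}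
    {C : ℝ≥0} (hg : ∀ i, LipschitzWith C (g i)) (hb : ∀ x, BddBelow (range fun i => g i x)) :
    LipschitzWith C fun x => ⨅ i, g i x := by
  refine LipschitzWith.of_le_add_mul C fun x y => ?_
  rw [← sub_le_iff_le_add]
  refine le_ciInf fun i => ?_
  rw [sub_le_iff_le_add]
  exact (ciInf_le (hb x) i).trans ((hg i).le_add_mul x y)

lemma LipschitzWith.integrable_of_integrable_norm {E : Type*} [NormedAddCommGroup E]
    [MeasurableSpace E] [BorelSpace E] {μ : Measure E} [IsFiniteMeasure μ] {f : E → ℝ} {L : ℝ≥0}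
    (hf : LipschitzWith L f) (hμ : Integrable (fun x : E => ‖x‖) μ) : Integrable f μ := by
  refine Integrable.mono' ((integrable_const ‖f 0‖).add (hμ.const_mul (L : ℝ)))
    hf.continuous.measurable.aestronglyMeasurable (ae_of_all _ fun x => ?_)
  have h1 := hf.dist_le_mul x 0
  rw [dist_zero_right, dist_eq_norm] at h1
  have h2 := norm_sub_norm_le (f x) (f 0)
  simp only [Pi.add_apply]
  linarith

lemma integrable_norm_gaussianReal : Integrable (fun x : ℝ => ‖x‖) (gaussianReal 0 1) :=
  (memLp_one_iff_integrable.1 (memLp_id_gaussianReal 1)).norm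

/-- The dual form of the quadratic transportation inequality for the standard Gaussian measure
on the line. -/
lemma lintegral_gaussianReal_le_exp_integral {u : ℝ → ℝ≥0∞} {f : ℝ → ℝ} {L : ℝ≥0}
    (hf : LipschitzWith L f) (h : ∀ x y, u x ≤ ENNReal.ofReal (rexp (f y + (x - y) ^ 2 / 2))) :
    ∫⁻ x, u x ∂(gaussianReal 0 1) ≤
      ENNReal.ofReal (rexp (∫ y, f y ∂(gaussianReal 0 1))) := by
  have fi : Integrable f (gaussianReal 0 1) :=
    hf.integrable_of_integrable_norm integrable_norm_gaussianReal
  set φ : ℝ → ℝ := fun x => ⨅ z, (f (x + z) + z ^ 2 / 2) with hφdef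
  have hb : ∀ x, BddBelow (range fun z => f (x + z) + z ^ 2 / 2) := by
    intro x
    refine ⟨f x - (L : ℝ) ^ 2 / 2, ?_⟩
    rintro _ ⟨z, rfl⟩
    have h1 := hf.le_add_mul x (x + z)
    rw [dist_self_add_right, Real.norm_eq_abs] at h1
    have h2 := sq_nonneg (|z| - L)
    have h3 := sq_abs z
    dsimp only
    nlinarith
  have hφL : LipschitzWith L φ := by
    refine LipschitzWith.ciInf (fun z => LipschitzWith.of_le_add_mul L fun x y => ?_) hb
    have := hf.le_add_mul (x + z) (y + z)
    rw [dist_add_right] at this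
    linarith
  have hφ : ∀ x y, φ x ≤ f y + (x - y) ^ 2 / 2 := by
    intro x y
    refine (ciInf_le (hb x) (y - x)).trans_eq ?_
    rw [add_sub_cancel]
    ring
  have hu : ∀ x, u x ≤ ENNReal.ofReal (rexp (φ x)) := by
    intro x
    by_cases hx : u x = 0
    · simp [hx]
    have hfin : u x ≠ ⊤ := ne_top_of_le_ne_top ENNReal.ofReal_ne_top (h x 0)
    have hpos : 0 < (u x).toReal := ENNReal.toReal_pos hx hfin
    rw [← ENNReal.ofReal_toReal hfin]
    refine ENNReal.ofReal_le_ofReal ?_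
    rw [← log_le_iff_le_exp hpos]
    refine le_ciInf fun z => ?_
    rw [log_le_iff_le_exp hpos]
    refine ENNReal.toReal_le_of_le_ofReal (exp_pos _).le ((h x (x + z)).trans_eq ?_)
    congr 3
    ring
  refine (lintegral_mono hu).trans ?_
  have hcov : AECover (gaussianReal 0 1) atTop fun n : ℕ => Ioc (-((n : ℝ) + 1)) ((n : ℝ) + 1) :=
    aecover_Ioc (tendsto_neg_atTop_atBot.comp
      (tendsto_atTop_add_const_right _ _ tendsto_natCast_atTop_atTop))
      (tendsto_atTop_add_const_right _ _ tendsto_natCast_atTop_atTop)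
  have hφc := hφL.continuous
  refine le_of_tendsto' (hcov.lintegral_tendsto_of_nat
    (f := fun x => ENNReal.ofReal (rexp (φ x))) (by fun_prop)) fun n => ?_
  have gc := continuous_gaussianPDFReal 0 1
  have hn : (0 : ℝ) < n + 1 := by positivity
  have hc : Continuous fun x => gaussianPDFReal 0 1 x * rexp (φ x) := by fun_prop
  refine le_trans (le_of_eq ?_)
    (ENNReal.ofReal_le_ofReal (intervalIntegral_exp_gaussianReal_le hφL.continuous fi hφ hn))
  rw [gaussianReal_of_var_ne_zero _ one_ne_zero, restrict_withDensity measurableSet_Ioc,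
    lintegral_withDensity_eq_lintegral_mul _ (measurable_gaussianPDF _ _) (by fun_prop),
    intervalIntegral.integral_of_le (by linarith),
    ofReal_integral_eq_lintegral_ofReal (hc.integrableOn_Ioc)
      (ae_of_all _ fun x => mul_nonneg (gaussianPDFReal_nonneg _ _ _) (exp_pos _).le)]
  refine lintegral_congr fun x => ?_
  simp only [Pi.mul_apply, gaussianPDF]
  rw [ENNReal.ofReal_mul (gaussianPDFReal_nonneg _ _ _)]

lemma integrable_norm_pi_gaussianReal (n : ℕ) :
    Integrable (fun x : Fin n → ℝ => ‖x‖) (Measure.pi fun _ => gaussianReal 0 1) := by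
  refine Integrable.mono' (g := fun x => ∑ i, ‖x i‖)
    (integrable_finsetSum _ fun i _ => ?_) (by fun_prop) (ae_of_all _ fun x => ?_)
  · exact integrable_comp_eval (μ := fun _ => gaussianReal 0 1) (f := fun y : ℝ => ‖y‖)
      integrable_norm_gaussianReal
  · rw [norm_norm, pi_norm_le_iff_of_nonneg (by positivity)]
    exact fun i => Finset.single_le_sum (f := fun i => ‖x i‖) (fun _ _ => norm_nonneg _)
      (Finset.mem_univ i)

lemma Fin.dist_cons {n : ℕ} (a b : ℝ) (x y : Fin n → ℝ) :
    dist (Fin.cons a x : Fin (n + 1) → ℝ) (Fin.cons b y) = max (dist a b) (dist x y) := by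
  apply le_antisymm
  · rw [dist_pi_le_iff (by positivity)]
    refine Fin.cases ?_ fun i => ?_
    · simp
    · simpa using Or.inr (dist_le_pi_dist x y i)
  · refine max_le ?_ ((dist_pi_le_iff dist_nonneg).2 fun i => ?_)
    · simpa using dist_le_pi_dist (Fin.cons a x : Fin (n + 1) → ℝ) (Fin.cons b y) 0
    · simpa using dist_le_pi_dist (Fin.cons a x : Fin (n + 1) → ℝ) (Fin.cons b y) i.succ

/-- The dual form of the quadratic transportation inequality for the product of standard Gaussian
measures. -/
lemma lintegral_pi_gaussianReal_le_exp_integral {n : ℕ} {u : (Fin n → ℝ) → ℝ≥0∞}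
    {f : (Fin n → ℝ) → ℝ} {L : ℝ≥0} (hu : Measurable u) (hf : LipschitzWith L f)
    (h : ∀ x y, u x ≤ ENNReal.ofReal (rexp (f y + (∑ i, (x i - y i) ^ 2) / 2))) :
    ∫⁻ x, u x ∂(Measure.pi fun _ => gaussianReal 0 1) ≤
      ENNReal.ofReal (rexp (∫ y, f y ∂(Measure.pi fun _ => gaussianReal 0 1))) := by
  induction n generalizing L with
  | zero =>
    rw [Measure.pi_of_empty _ 0, lintegral_dirac, integral_dirac]
    simpa using h 0 0
  | succ n ih =>
    set γ := gaussianReal 0 1 with hγ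
    set P : Measure (Fin n → ℝ) := Measure.pi fun _ => γ with hP
    have mp := (measurePreserving_piFinSuccAbove (fun _ : Fin (n + 1) => γ) 0).symm
    have happ : ∀ q : ℝ × (Fin n → ℝ),
        (MeasurableEquiv.piFinSuccAbove (fun _ : Fin (n + 1) => ℝ) 0).symm q
          = Fin.cons q.1 q.2 := by
      intro q
      simp [MeasurableEquiv.piFinSuccAbove_symm_apply, Fin.insertNthEquiv]
    have fi : Integrable f (Measure.pi fun _ => γ) :=
      hf.integrable_of_integrable_norm (integrable_norm_pi_gaussianReal (n + 1))
    have fi' := (mp.integrable_comp_emb (MeasurableEquiv.measurableEmbedding _)).2 fi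
    rw [← mp.lintegral_comp_emb (MeasurableEquiv.measurableEmbedding _),
      ← mp.integral_comp (MeasurableEquiv.measurableEmbedding _)]
    simp only [Function.comp_def, happ] at fi' ⊢
    have hcm : Measurable fun q : ℝ × (Fin n → ℝ) => (Fin.cons q.1 q.2 : Fin (n + 1) → ℝ) := by
      have := mp.measurable
      simpa only [funext happ] using this
    have hum : Measurable fun q : ℝ × (Fin n → ℝ) => u (Fin.cons q.1 q.2) := hu.comp hcm
    rw [lintegral_prod _ hum.aemeasurable, integral_prod _ fi']
    have hfL : ∀ a, LipschitzWith L fun x : Fin n → ℝ => f (Fin.cons a x) := by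
      intro a
      refine LipschitzWith.of_dist_le_mul fun x y => (hf.dist_le_mul _ _).trans_eq ?_
      rw [Fin.dist_cons, dist_self, max_eq_right dist_nonneg]
    have hfi : ∀ a, Integrable (fun x : Fin n → ℝ => f (Fin.cons a x)) P := fun a =>
      (hfL a).integrable_of_integrable_norm (integrable_norm_pi_gaussianReal n)
    have hFL : LipschitzWith L fun a => ∫ x, f (Fin.cons a x) ∂P := by
      refine LipschitzWith.of_le_add_mul L fun a b => ?_
      have hc : ∫ x, (f (Fin.cons b x) + L * dist a b) ∂P
          = ∫ x, f (Fin.cons b x) ∂P + L * dist a b := by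
        rw [integral_add (hfi b) (integrable_const _)]
        simp
      rw [← hc]
      refine integral_mono (hfi a) ((hfi b).add (integrable_const _)) fun x => ?_
      refine (hf.le_add_mul (Fin.cons a x) (Fin.cons b x)).trans_eq ?_
      rw [Fin.dist_cons, dist_self, max_eq_left dist_nonneg]
    refine lintegral_gaussianReal_le_exp_integral hFL fun a b => ?_
    have hc : ∫ x, (f (Fin.cons b x) + (a - b) ^ 2 / 2) ∂P
        = ∫ x, f (Fin.cons b x) ∂P + (a - b) ^ 2 / 2 := by
      rw [integral_add (hfi b) (integrable_const _)]
      simp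
    rw [← hc]
    refine ih (u := fun x => u (Fin.cons a x)) (L := L)
      (hu.comp (hcm.comp measurable_prodMk_left)) ?_ fun x y => ?_
    · simpa using (hfL b).add (LipschitzWith.const ((a - b) ^ 2 / 2))
    · refine (h (Fin.cons a x) (Fin.cons b y)).trans_eq ?_
      simp only [Fin.sum_univ_succ, Fin.cons_zero, Fin.cons_succ]
      congr 2
      ring

lemma lintegral_pi_prod_eq_prod {n : ℕ} {μ : Measure ℝ} [SigmaFinite μ] {g : Fin n → ℝ → ℝ≥0∞}
    (hg : ∀ i, Measurable (g i)) :
    ∫⁻ x, ∏ i, g i (x i) ∂(Measure.pi fun _ => μ) = ∏ i, ∫⁻ x, g i x ∂μ := by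
  induction n with
  | zero =>
    rw [Measure.pi_of_empty _ 0, lintegral_dirac]
    simp
  | succ n ih =>
    have mp := (measurePreserving_piFinSuccAbove (fun _ : Fin (n + 1) => μ) 0).symm
    have hgm : Measurable fun x : Fin n → ℝ => ∏ i, g i.succ (x i) :=
      Finset.measurable_fun_prod _ fun i _ => (hg _).comp (measurable_pi_apply i)
    rw [← mp.lintegral_comp_emb (MeasurableEquiv.measurableEmbedding _), Fin.prod_univ_succ,
      ← ih fun i => hg i.succ, ← lintegral_prod_mul (hg 0).aemeasurable hgm.aemeasurable]
    simp [MeasurableEquiv.piFinSuccAbove_symm_apply, Fin.insertNthEquiv, Fin.prod_univ_succ]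

lemma pi_withDensity {n : ℕ} {μ : Measure ℝ} [SigmaFinite μ] {g : ℝ → ℝ≥0∞}
    (hg : Measurable g) [SigmaFinite (μ.withDensity g)] :
    (Measure.pi fun _ : Fin n => μ.withDensity g) =
      (Measure.pi fun _ : Fin n => μ).withDensity fun x => ∏ i, g (x i) := by
  refine Measure.pi_eq fun s hs => ?_
  rw [withDensity_apply _ (MeasurableSet.univ_pi hs),
    ← lintegral_indicator (MeasurableSet.univ_pi hs)]
  have h1 : ∀ i, μ.withDensity g (s i) = ∫⁻ x, (s i).indicator g x ∂μ := fun i => by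
    rw [withDensity_apply g (hs i), lintegral_indicator (hs i)]
  simp_rw [h1]
  rw [← lintegral_pi_prod_eq_prod fun i => hg.indicator (hs i)]
  refine lintegral_congr fun x => ?_
  by_cases hx : x ∈ univ.pi s
  · rw [indicator_of_mem hx]
    exact Finset.prod_congr rfl fun i _ => (indicator_of_mem (hx i trivial) _).symm
  · rw [indicator_of_notMem hx]
    simp only [mem_univ_pi, not_forall] at hx
    obtain ⟨i, hi⟩ := hx
    exact (Finset.prod_eq_zero (Finset.mem_univ i) (indicator_of_notMem hi _)).symm

lemma measurePreserving_toLp_stdGaussian (n : ℕ) :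
    MeasurePreserving (MeasurableEquiv.toLp 2 (Fin n → ℝ))
      (Measure.pi fun _ => gaussianReal 0 1) (stdGaussian n) := by
  refine ⟨MeasurableEquiv.measurable _, ?_⟩
  have hd : (Measure.pi fun _ : Fin n => gaussianReal 0 1) =
      (volume : Measure (Fin n → ℝ)).withDensity fun x => ∏ i, gaussianPDF 0 1 (x i) := by
    have : IsProbabilityMeasure ((volume : Measure ℝ).withDensity (gaussianPDF 0 1)) := by
      rw [← gaussianReal_of_var_ne_zero _ one_ne_zero]
      infer_instance
    rw [gaussianReal_of_var_ne_zero _ one_ne_zero, pi_withDensity (measurable_gaussianPDF _ _)]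
    rfl
  ext s hs
  have vp := PiLp.volume_preserving_toLp (Fin n)
  rw [Measure.map_apply (MeasurableEquiv.measurable _) hs, hd,
    withDensity_apply _ (MeasurableEquiv.measurable _ hs), _root_.stdGaussian, withDensity_apply _ hs,
    ← vp.setLIntegral_comp_preimage_emb (MeasurableEquiv.toLp 2 _).measurableEmbedding]
  refine lintegral_congr fun x => ?_
  simp only [gaussianPDF]
  rw [← ENNReal.ofReal_prod_of_nonneg fun i _ => gaussianPDFReal_nonneg _ _ _]
  congr 1
  simp only [gaussianPDFReal, Finset.prod_mul_distrib, ← Real.exp_sum]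
  congr 1
  · simp only [Finset.prod_const, Finset.card_univ, Fintype.card_fin, NNReal.coe_one, mul_one]
    rw [Real.sqrt_eq_rpow, ← Real.rpow_neg (by positivity), ← Real.rpow_natCast,
      ← Real.rpow_mul (by positivity)]
    congr 1
    ring
  · congr 1
    rw [EuclideanSpace.norm_sq_eq, ← Finset.sum_div, Finset.sum_neg_distrib]
    simp

lemma exists_norm_le_of_bddAbove_inner {n : ℕ} {K : Set (EuclideanSpace ℝ (Fin n))}
    (hbdd : ∀ x : EuclideanSpace ℝ (Fin n),
      BddAbove (Set.range fun t : K => ⟪x, (t : EuclideanSpace ℝ (Fin n))⟫)) :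
    ∃ C : ℝ≥0, ∀ t ∈ K, ‖t‖ ≤ C := by
  choose B hB using hbdd
  have hB' : ∀ x, ∀ t ∈ K, ⟪x, t⟫ ≤ B x := fun x t ht => hB x ⟨⟨t, ht⟩, rfl⟩
  set e : Fin n → EuclideanSpace ℝ (Fin n) := fun i => EuclideanSpace.single i 1 with he
  refine ⟨Real.toNNReal (√(∑ i, (max (B (e i)) (B (-e i))) ^ 2)), fun t ht => ?_⟩
  rw [Real.coe_toNNReal _ (Real.sqrt_nonneg _), EuclideanSpace.norm_eq]
  refine Real.sqrt_le_sqrt (Finset.sum_le_sum fun i _ => ?_)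
  have h1 := hB' (e i) t ht
  have h2 := hB' (-e i) t ht
  have h3 : ⟪e i, t⟫ = t i := by simp [he, EuclideanSpace.inner_single_left]
  rw [inner_neg_left] at h2
  rw [h3] at h1 h2
  have h4 : ‖t i‖ ≤ max (B (e i)) (B (-e i)) :=
    abs_le'.2 ⟨h1.trans (le_max_left _ _), h2.trans (le_max_right _ _)⟩
  gcongr

end

theorem tsirelson_vitale (n : ℕ) (K : Set (EuclideanSpace ℝ (Fin n)))
    (hKne : K.Nonempty)
    (hbdd : ∀ x : EuclideanSpace ℝ (Fin n),
      BddAbove (Set.range fun t : K => ⟪x, (t : EuclideanSpace ℝ (Fin n))⟫))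
    (hbddZ : ∀ x : EuclideanSpace ℝ (Fin n),
      BddAbove (Set.range fun t : K =>
        ⟪x, (t : EuclideanSpace ℝ (Fin n))⟫ - ‖(t : EuclideanSpace ℝ (Fin n))‖ ^ 2 / 2))
    (hint : Integrable (gaussWidthFn K) (stdGaussian n)) :
    ∫⁻ x, ENNReal.ofReal (Real.exp
        (⨆ t : K, (⟪x, (t : EuclideanSpace ℝ (Fin n))⟫
          - ‖(t : EuclideanSpace ℝ (Fin n))‖ ^ 2 / 2))) ∂(stdGaussian n)
      ≤ ENNReal.ofReal (Real.exp (∫ x, gaussWidthFn K x ∂(stdGaussian n))) := by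
  obtain ⟨C, hC⟩ := exists_norm_le_of_bddAbove_inner hbdd
  have : Nonempty K := hKne.to_subtype
  have hinner : ∀ t : K, LipschitzWith C fun x : EuclideanSpace ℝ (Fin n) =>
      ⟪x, (t : EuclideanSpace ℝ (Fin n))⟫ := by
    refine fun t => LipschitzWith.of_le_add_mul C fun x y => ?_
    rw [← sub_le_iff_le_add', ← inner_sub_left, dist_eq_norm, mul_comm]
    exact (real_inner_le_norm _ _).trans (by gcongr; exact hC t t.2)
  have hw : LipschitzWith C (gaussWidthFn K) := LipschitzWith.ciSup hinner hbdd
  have hZ := LipschitzWith.ciSup (fun t : K => by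
    simpa using (hinner t).sub
      (LipschitzWith.const (‖(t : EuclideanSpace ℝ (Fin n))‖ ^ 2 / 2))) hbddZ
  have mp := measurePreserving_toLp_stdGaussian n
  have me := (MeasurableEquiv.toLp 2 (Fin n → ℝ)).measurableEmbedding
  rw [← mp.lintegral_comp_emb me, ← mp.integral_comp me]
  refine lintegral_pi_gaussianReal_le_exp_integral
    (ENNReal.measurable_ofReal.comp (measurable_exp.comp (hZ.continuous.measurable.comp
      (MeasurableEquiv.measurable _)))) (hw.comp (PiLp.lipschitzWith_toLp 2 _)) fun x y => ?_
  refine ENNReal.ofReal_le_ofReal (exp_le_exp.2 (ciSup_le fun t => ?_))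
  set X : EuclideanSpace ℝ (Fin n) := MeasurableEquiv.toLp 2 (Fin n → ℝ) x with hX
  set Y : EuclideanSpace ℝ (Fin n) := MeasurableEquiv.toLp 2 (Fin n → ℝ) y with hY
  have hs : ∑ i, (x i - y i) ^ 2 = ‖X - Y‖ ^ 2 := by
    rw [EuclideanSpace.norm_sq_eq]
    simp [hX, hY]
  have h1 : ⟪Y, (t : EuclideanSpace ℝ (Fin n))⟫ ≤ gaussWidthFn K Y := le_ciSup (hbdd Y) t
  have h2 := norm_sub_sq_real (X - Y) (t : EuclideanSpace ℝ (Fin n))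
  rw [inner_sub_left] at h2
  have h3 := sq_nonneg ‖X - Y - t‖
  rw [hs]
  linarith
end
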